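/- (Super/sub-translation property of SlideVaR.) Let X be an integrable random variable and a ∈ ℝ. If a ≥ 0 then SlideVaR_{α,β}^φ(X + a) ≥ SlideVaR_{α,β}^φ(X) + a, and if a ≤ 0 then SlideVaR_{α,β}^φ(X + a) ≤ SlideVaR_{α,β}^φ(X) + a. -/

import Mathlib

open MeasureTheory

/-- Quantile function `F_X^{-1}(p) = inf {x : F_X(x) >= p}` of the loss `X` under `P`. -/
noncomputable def quantile {Ω : Type*} [MeasurableSpace Ω] (P : Measure Ω)
    (X : Ω → ℝ) (p : ℝ) : ℝ :=
  sInf {x : ℝ | p ≤ (P {ω | X ω ≤ x}).toReal}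

/-- Tail thickness `U_β^φ(X) = ∫_0^1 F_X^{-1}(p) φ_β(p) dp`. -/
noncomputable def tailThickness {Ω : Type*} [MeasurableSpace Ω] (P : Measure Ω)
    (φ : ℝ → ℝ) (X : Ω → ℝ) : ℝ :=
  ∫ p in (0:ℝ)..1, quantile P X p * φ p

/-- Value at risk `VaR_α(X) = F_X^{-1}(α)`. -/
noncomputable def VaR {Ω : Type*} [MeasurableSpace Ω] (P : Measure Ω)
    (α : ℝ) (X : Ω → ℝ) : ℝ :=
  quantile P X α

/-- Conditional value at risk `CVaR_α(X) = (1/(1-α)) ∫_α^1 F_X^{-1}(p) dp`. -/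
noncomputable def CVaR {Ω : Type*} [MeasurableSpace Ω] (P : Measure Ω)
    (α : ℝ) (X : Ω → ℝ) : ℝ :=
  (1 / (1 - α)) * ∫ p in α..1, quantile P X p

/-- `SlideVaR_{α,β}^φ(X) = S(U_β^φ(X))·CVaR_α(X) + (1 - S(U_β^φ(X)))·VaR_β(X)`. -/
noncomputable def SlideVaR {Ω : Type*} [MeasurableSpace Ω] (P : Measure Ω)
    (α β : ℝ) (φ S : ℝ → ℝ) (X : Ω → ℝ) : ℝ :=
  S (tailThickness P φ X) * CVaR P α X
    + (1 - S (tailThickness P φ X)) * VaR P β X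

open ProbabilityTheory Set Filter Topology

section Quantile

variable {Ω : Type*} [MeasurableSpace Ω] {P : Measure Ω} [IsProbabilityMeasure P]
  {X : Ω → ℝ} {p : ℝ}

theorem toReal_measure_le_eq_cdf_map (hX : AEMeasurable X P) (x : ℝ) :
    (P {ω | X ω ≤ x}).toReal = cdf (P.map X) x := by
  have := Measure.isProbabilityMeasure_map hX
  rw [cdf_eq_real, Measure.real, Measure.map_apply_of_aemeasurable hX measurableSet_Iic]
  rfl

theorem quantile_set_nonempty (hX : AEMeasurable X P) (hp : p < 1) :
    {x : ℝ | p ≤ (P {ω | X ω ≤ x}).toReal}.Nonempty := by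
  obtain ⟨x, hx⟩ := ((tendsto_cdf_atTop (P.map X)).eventually (eventually_ge_nhds hp)).exists
  exact ⟨x, by rwa [mem_ofPred_eq, toReal_measure_le_eq_cdf_map hX]⟩

theorem quantile_set_bddBelow (hX : AEMeasurable X P) (hp : 0 < p) :
    BddBelow {x : ℝ | p ≤ (P {ω | X ω ≤ x}).toReal} := by
  obtain ⟨x, hx⟩ := ((tendsto_cdf_atBot (P.map X)).eventually (eventually_lt_nhds hp)).exists
  refine ⟨x, fun y hy => ?_⟩
  rw [mem_ofPred_eq, toReal_measure_le_eq_cdf_map hX] at hy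
  by_contra! h
  exact absurd (hy.trans (monotone_cdf _ h.le)) hx.not_ge

/-- The Galois connection between the quantile function and the distribution function. -/
theorem quantile_le_iff (hX : AEMeasurable X P) (hp : p ∈ Ioo (0 : ℝ) 1) (x : ℝ) :
    quantile P X p ≤ x ↔ p ≤ cdf (P.map X) x := by
  constructor
  · intro h
    have hright : Tendsto (cdf (P.map X)) (𝓝[>] x) (𝓝 (cdf (P.map X) x)) :=
      ((cdf (P.map X)).right_continuous x).mono Ioi_subset_Ici_self
    refine ge_of_tendsto hright ?_
    filter_upwards [self_mem_nhdsWithin] with y hy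
    obtain ⟨z, hz, hzy⟩ := exists_lt_of_csInf_lt (quantile_set_nonempty hX hp.2)
      (lt_of_le_of_lt h hy)
    rw [mem_ofPred_eq, toReal_measure_le_eq_cdf_map hX] at hz
    exact hz.trans (monotone_cdf _ hzy.le)
  · intro h
    refine csInf_le (quantile_set_bddBelow hX hp.1) ?_
    rwa [mem_ofPred_eq, toReal_measure_le_eq_cdf_map hX]

theorem quantile_monotoneOn (hX : AEMeasurable X P) :
    MonotoneOn (quantile P X) (Ioo 0 1) := by
  intro p hp q hq hpq
  rw [quantile_le_iff hX hp]
  exact hpq.trans ((quantile_le_iff hX hq _).1 le_rfl)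

theorem quantile_add_const (hX : AEMeasurable X P) (hp : p ∈ Ioo (0 : ℝ) 1) (a : ℝ) :
    quantile P (fun ω => X ω + a) p = quantile P X p + a := by
  have hXa : AEMeasurable (fun ω => X ω + a) P := hX.add_const a
  refine eq_of_forall_ge_iff fun x => ?_
  rw [quantile_le_iff hXa hp, ← toReal_measure_le_eq_cdf_map hXa, ← le_sub_iff_add_le,
    quantile_le_iff hX hp, ← toReal_measure_le_eq_cdf_map hX]
  simp only [le_sub_iff_add_le]

theorem aemeasurable_quantile (hX : AEMeasurable X P) :
    AEMeasurable (quantile P X) (volume.restrict (Ioo 0 1)) :=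
  aemeasurable_restrict_of_monotoneOn measurableSet_Ioo (quantile_monotoneOn hX)

/-- Under the uniform law on `(0, 1)`, the quantile function of `X` has the law of `X`. -/
theorem map_quantile (hX : AEMeasurable X P) :
    (volume.restrict (Ioo (0 : ℝ) 1)).map (quantile P X) = P.map X := by
  have := Measure.isProbabilityMeasure_map hX
  refine Measure.ext_of_Iic _ _ fun x => ?_
  rw [Measure.map_apply_of_aemeasurable (aemeasurable_quantile hX) measurableSet_Iic,
    Measure.restrict_apply' measurableSet_Ioo, ← ofReal_cdf]
  have hset : quantile P X ⁻¹' Iic x ∩ Ioo 0 1 = Iic (cdf (P.map X) x) ∩ Ioo 0 1 := by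
    ext p
    simp only [mem_inter_iff, mem_preimage, mem_Iic, and_congr_left_iff]
    exact fun hp => quantile_le_iff hX hp x
  rw [hset, measure_congr ((ae_eq_refl _).inter Ioo_ae_eq_Ioc), inter_comm,
    Ioc_inter_Iic, Real.volume_Ioc, min_eq_right (cdf_le_one _ x), sub_zero]

theorem integrableOn_quantile (hX : Integrable X P) :
    IntegrableOn (quantile P X) (Ioo 0 1) := by
  have hm := hX.aemeasurable
  have hid : Integrable id (P.map X) :=
    (integrable_map_measure aestronglyMeasurable_id hm).2 hX
  rw [← map_quantile hm] at hid
  exact (integrable_map_measure aestronglyMeasurable_id (aemeasurable_quantile hm)).1 hid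

end Quantile

section RiskMeasures

variable {Ω : Type*} [MeasurableSpace Ω] {P : Measure Ω} [IsProbabilityMeasure P]
  {X : Ω → ℝ} {α β : ℝ}

theorem intervalIntegrable_quantile (hX : Integrable X P) (hα₀ : 0 ≤ α) (hα : α ≤ 1) :
    IntervalIntegrable (quantile P X) volume α 1 := by
  rw [intervalIntegrable_iff_integrableOn_Ioo_of_le hα]
  exact (integrableOn_quantile hX).mono_set (Ioo_subset_Ioo_left hα₀)

theorem CVaR_add_const (hX : Integrable X P) (hα₀ : 0 ≤ α) (hα : α < 1) (a : ℝ) :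
    CVaR P α (fun ω => X ω + a) = CVaR P α X + a := by
  have h : ∫ p in α..1, quantile P (fun ω => X ω + a) p = ∫ p in α..1, (quantile P X p + a) := by
    simp only [intervalIntegral.integral_of_le hα.le, integral_Ioc_eq_integral_Ioo]
    exact setIntegral_congr_fun measurableSet_Ioo fun p hp =>
      quantile_add_const hX.aemeasurable ⟨hα₀.trans_lt hp.1, hp.2⟩ a
  have h1 : 1 - α ≠ 0 := (sub_pos.2 hα).ne'
  rw [CVaR, CVaR, h, intervalIntegral.integral_add (intervalIntegrable_quantile hX hα₀ hα.le)
    intervalIntegrable_const, intervalIntegral.integral_const, smul_eq_mul]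
  field_simp

theorem VaR_le_CVaR (hX : Integrable X P) (hβ : 0 < β) (hβα : β ≤ α) (hα : α < 1) :
    VaR P β X ≤ CVaR P α X := by
  have hα₀ : 0 < α := hβ.trans_le hβα
  have h : ∫ _ in α..1, VaR P β X ≤ ∫ p in α..1, quantile P X p :=
    intervalIntegral.integral_mono_on_of_le_Ioo hα.le intervalIntegrable_const
      (intervalIntegrable_quantile hX hα₀.le hα.le) fun p hp =>
        quantile_monotoneOn hX.aemeasurable ⟨hβ, hβα.trans_lt hα⟩ ⟨hα₀.trans hp.1, hp.2⟩
          (hβα.trans hp.1.le)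
  rw [intervalIntegral.integral_const, smul_eq_mul] at h
  rwa [CVaR, one_div_mul_eq_div, le_div_iff₀' (sub_pos.2 hα)]

theorem tailThickness_add_const {φ : ℝ → ℝ} (hX : AEMeasurable X P)
    (hφnorm : ∫ p in (0 : ℝ)..1, φ p = 1)
    (hφX : IntervalIntegrable (fun p => quantile P X p * φ p) volume 0 1) (a : ℝ) :
    tailThickness P φ (fun ω => X ω + a) = tailThickness P φ X + a := by
  have hφ : IntervalIntegrable φ volume 0 1 :=
    intervalIntegral.intervalIntegrable_of_integral_ne_zero (by simp [hφnorm])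
  have h : ∫ p in (0 : ℝ)..1, quantile P (fun ω => X ω + a) p * φ p =
      ∫ p in (0 : ℝ)..1, (quantile P X p * φ p + a * φ p) := by
    simp only [intervalIntegral.integral_of_le zero_le_one, integral_Ioc_eq_integral_Ioo]
    refine setIntegral_congr_fun measurableSet_Ioo fun p hp => ?_
    simp only [quantile_add_const hX hp a, add_mul]
  rw [tailThickness, tailThickness, h, intervalIntegral.integral_add hφX (hφ.const_mul a),
    intervalIntegral.integral_const_mul, hφnorm, mul_one]

/-- The product of the quantile function with a spectrum that vanishes below `β` and is
non-decreasing above it is integrable. -/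
theorem intervalIntegrable_quantile_mul {φ : ℝ → ℝ} (hX : Integrable X P)
    (hβ₁ : β ≤ 1) (hφ0 : ∀ p ∈ Ico (0 : ℝ) β, φ p = 0)
    (hφpos : ∀ p ∈ Icc β 1, 0 ≤ φ p) (hφmono : MonotoneOn φ (Icc β 1)) :
    IntervalIntegrable (fun p => quantile P X p * φ p) volume 0 1 := by
  have hmono : MonotoneOn φ (Ioo 0 1) := by
    intro p hp q hq hpq
    rcases lt_or_ge p β with h | h
    · rw [hφ0 p ⟨hp.1.le, h⟩]
      rcases lt_or_ge q β with h' | h'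
      · rw [hφ0 q ⟨hq.1.le, h'⟩]
      · exact hφpos q ⟨h', hq.2.le⟩
    · exact hφmono ⟨h, hp.2.le⟩ ⟨h.trans hpq, hq.2.le⟩ hpq
  rw [intervalIntegrable_iff_integrableOn_Ioo_of_le zero_le_one]
  refine (integrableOn_quantile hX).mul_bdd (c := φ 1)
    (aemeasurable_restrict_of_monotoneOn measurableSet_Ioo hmono).aestronglyMeasurable ?_
  filter_upwards [ae_restrict_mem measurableSet_Ioo] with p hp
  have h1 : (1 : ℝ) ∈ Icc β 1 := ⟨hβ₁, le_rfl⟩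
  rcases lt_or_ge p β with h | h
  · simpa [hφ0 p ⟨hp.1.le, h⟩] using hφpos 1 h1
  · rw [Real.norm_of_nonneg (hφpos p ⟨h, hp.2.le⟩)]
    exact hφmono ⟨h, hp.2.le⟩ h1 hp.2.le

end RiskMeasures

theorem slideVaR_translation
    {Ω : Type*} [MeasurableSpace Ω] (P : Measure Ω) [IsProbabilityMeasure P]
    (α β : ℝ) (hβ : 0 < β) (hβα : β ≤ α) (hα : α < 1) (φ : ℝ → ℝ)
    (hφ0 : ∀ p ∈ Set.Ico (0:ℝ) β, φ p = 0)
    (hφpos : ∀ p ∈ Set.Icc β 1, 0 ≤ φ p)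
    (hφmono : MonotoneOn φ (Set.Icc β 1))
    (hφnorm : ∫ p in (0:ℝ)..1, φ p = 1)
    (S : ℝ → ℝ) (hS : Monotone S) (hS01 : ∀ x, S x ∈ Set.Icc (0:ℝ) 1)
    (X : Ω → ℝ) (hX : Integrable X P) (a : ℝ) :
    (a ≥ 0 → SlideVaR P α β φ S X + a ≤ SlideVaR P α β φ S (fun ω => X ω + a)) ∧
    (a ≤ 0 → SlideVaR P α β φ S (fun ω => X ω + a) ≤ SlideVaR P α β φ S X + a) := by
  have hβ₁ : β < 1 := hβα.trans_lt hα
  have hU := tailThickness_add_const hX.aemeasurable hφnorm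
    (intervalIntegrable_quantile_mul hX hβ₁.le hφ0 hφpos hφmono) a
  have hV : VaR P β (fun ω => X ω + a) = VaR P β X + a :=
    quantile_add_const hX.aemeasurable ⟨hβ, hβ₁⟩ a
  have hVC := VaR_le_CVaR hX hβ hβα hα
  simp only [SlideVaR, hU, hV, CVaR_add_const hX (hβ.le.trans hβα) hα a]
  constructor
  · intro ha
    have hs : S (tailThickness P φ X) ≤ S (tailThickness P φ X + a) := hS (by linarith)
    nlinarith [mul_le_mul_of_nonneg_right hs (sub_nonneg.2 hVC)]
  · intro ha
    have hs : S (tailThickness P φ X + a) ≤ S (tailThickness P φ X) := hS (by linarith)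
    nlinarith [mul_le_mul_of_nonneg_right hs (sub_nonneg.2 hVC)]
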